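/- arXiv:nlin/0305048 — 2 statements merged into one kernel-verified Lean document; each statement's English description precedes it below -/
import Mathlib

section
/- With coordinates (a₁,a₂,a₃,a₄,α₁,α₂,α₃,β₁,β₂,γ) on ℝ¹⁰, define V₁, V₂, V₃ as in the induced isometry action and T₁ = 3∂_{a₁} + ∂_{a₃}, T₂ = ∂_{a₂} + 3∂_{a₄}, T₃ = ∂_{α₁} − ∂_{α₃}. Then under the Lie bracket of vector fields the following relations hold: [T₁,T₂] = [T₁,T₃] = [T₂,T₃] = 0; [V₁,T₁] = [V₁,T₂] = 0 and [V₁,T₃] = T₂; [V₂,T₁] = [V₂,T₂] = 0 and [V₂,T₃] = −T₁; [V₃,T₁] = T₂, [V₃,T₂] = −T₁, [V₃,T₃] = 0. In particular, the six vector fields {V₁,V₂,V₃,T₁,T₂,T₃} span a six-dimensional Lie algebra of vector fields on ℝ¹⁰. -/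
/- STATEMENT 8: Commutator relations between the induced isometry-action vector fields
V₁, V₂, V₃ and the trivial-direction vector fields T₁, T₂, T₃ on the parameter space
ℝ¹⁰; together the six vector fields span a six-dimensional Lie algebra. -/

noncomputable section

/-- Lie bracket of vector fields: [V,W](x) = DW(x)(V(x)) − DV(x)(W(x)). -/
def lieBracket {E : Type*} [NormedAddCommGroup E] [NormedSpace ℝ E]
    (V W : E → E) : E → E :=
  fun x => fderiv ℝ W x (V x) - fderiv ℝ V x (W x)

/- Coordinates on ℝ¹⁰ = Fin 10 → ℝ:
0:a₁, 1:a₂, 2:a₃, 3:a₄, 4:α₁, 5:α₂, 6:α₃, 7:β₁, 8:β₂, 9:γ. -/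

def V₁ : (Fin 10 → ℝ) → (Fin 10 → ℝ) :=
  fun x => ![0, -x 4, -x 5, 3 * x 6, 0, -2 * x 7, 2 * x 8, 0, -x 9, 0]

def V₂ : (Fin 10 → ℝ) → (Fin 10 → ℝ) :=
  fun x => ![3 * x 4, x 5, -x 6, 0, 2 * x 7, 2 * x 8, 0, x 9, 0, 0]

def V₃ : (Fin 10 → ℝ) → (Fin 10 → ℝ) :=
  fun x => ![3 * x 1, 2 * x 2 - x 0, x 3 - 2 * x 1, -3 * x 2,
             x 5, -2 * (x 4 + x 6), x 5, x 8, -x 7, 0]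

def T₁ : (Fin 10 → ℝ) → (Fin 10 → ℝ) :=
  fun _ => ![3, 0, 1, 0, 0, 0, 0, 0, 0, 0]

def T₂ : (Fin 10 → ℝ) → (Fin 10 → ℝ) :=
  fun _ => ![0, 1, 0, 3, 0, 0, 0, 0, 0, 0]

def T₃ : (Fin 10 → ℝ) → (Fin 10 → ℝ) :=
  fun _ => ![0, 0, 0, 0, 1, 0, -1, 0, 0, 0]

lemma lieBracket_const_const {E : Type*} [NormedAddCommGroup E] [NormedSpace ℝ E] (v w x : E) :
    lieBracket (fun _ => v) (fun _ => w) x = 0 := by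
  simp [lieBracket]

lemma lieBracket_const_of_isLinearMap {E : Type*} [NormedAddCommGroup E] [NormedSpace ℝ E]
    [FiniteDimensional ℝ E] {V : E → E} (hV : IsLinearMap ℝ V) (w x : E) :
    lieBracket V (fun _ => w) x = -V w := by
  have h : fderiv ℝ V x = LinearMap.toContinuousLinearMap hV.mk' :=
    (LinearMap.toContinuousLinearMap hV.mk').hasFDerivAt.fderiv
  simp [lieBracket, h]

lemma isLinearMap_V₁ : IsLinearMap ℝ V₁ := by
  constructor <;> intros <;> ext i <;> fin_cases i <;> simp [V₁] <;> ring

lemma isLinearMap_V₂ : IsLinearMap ℝ V₂ := by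
  constructor <;> intros <;> ext i <;> fin_cases i <;> simp [V₂] <;> ring

lemma isLinearMap_V₃ : IsLinearMap ℝ V₃ := by
  constructor <;> intros <;> ext i <;> fin_cases i <;> simp [V₃] <;> ring

lemma linearIndependent_vectorFields :
    LinearIndependent ℝ
      (![V₁, V₂, V₃, T₁, T₂, T₃] : Fin 6 → ((Fin 10 → ℝ) → (Fin 10 → ℝ))) := by
  rw [Fintype.linearIndependent_iff]
  intro g hg
  have h (x : Fin 10 → ℝ) (j : Fin 10) := congrFun (congrFun hg x) j
  simp only [Fin.sum_univ_six] at h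
  have hT₁ := h 0 0
  have hT₂ := h 0 1
  have hT₃ := h 0 4
  have hV₁ := h (Pi.single 9 1) 8
  have hV₂ := h (Pi.single 9 1) 7
  have hV₃ := h (Pi.single 8 1) 7
  simp [V₁, V₂, V₃, T₁, T₂, T₃] at hT₁ hT₂ hT₃ hV₁ hV₂ hV₃
  intro i
  fin_cases i <;> assumption

theorem six_dimensional_lie_algebra_of_vector_fields :
    (∀ x, lieBracket T₁ T₂ x = 0) ∧
    (∀ x, lieBracket T₁ T₃ x = 0) ∧
    (∀ x, lieBracket T₂ T₃ x = 0) ∧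
    (∀ x, lieBracket V₁ T₁ x = 0) ∧
    (∀ x, lieBracket V₁ T₂ x = 0) ∧
    (∀ x, lieBracket V₁ T₃ x = T₂ x) ∧
    (∀ x, lieBracket V₂ T₁ x = 0) ∧
    (∀ x, lieBracket V₂ T₂ x = 0) ∧
    (∀ x, lieBracket V₂ T₃ x = -T₁ x) ∧
    (∀ x, lieBracket V₃ T₁ x = T₂ x) ∧
    (∀ x, lieBracket V₃ T₂ x = -T₁ x) ∧
    (∀ x, lieBracket V₃ T₃ x = 0) ∧
    LinearIndependent ℝ
      (![V₁, V₂, V₃, T₁, T₂, T₃] : Fin 6 → ((Fin 10 → ℝ) → (Fin 10 → ℝ))) := by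
  refine ⟨lieBracket_const_const _ _, lieBracket_const_const _ _, lieBracket_const_const _ _,
    fun x => (lieBracket_const_of_isLinearMap isLinearMap_V₁ (T₁ x) x).trans ?_,
    fun x => (lieBracket_const_of_isLinearMap isLinearMap_V₁ (T₂ x) x).trans ?_,
    fun x => (lieBracket_const_of_isLinearMap isLinearMap_V₁ (T₃ x) x).trans ?_,
    fun x => (lieBracket_const_of_isLinearMap isLinearMap_V₂ (T₁ x) x).trans ?_,
    fun x => (lieBracket_const_of_isLinearMap isLinearMap_V₂ (T₂ x) x).trans ?_,
    fun x => (lieBracket_const_of_isLinearMap isLinearMap_V₂ (T₃ x) x).trans ?_,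
    fun x => (lieBracket_const_of_isLinearMap isLinearMap_V₃ (T₁ x) x).trans ?_,
    fun x => (lieBracket_const_of_isLinearMap isLinearMap_V₃ (T₂ x) x).trans ?_,
    fun x => (lieBracket_const_of_isLinearMap isLinearMap_V₃ (T₃ x) x).trans ?_,
    linearIndependent_vectorFields⟩ <;>
  ext i <;> fin_cases i <;> simp [V₁, V₂, V₃, T₁, T₂, T₃] <;> norm_num
end
end

section
/- With coordinates (a₁,a₂,a₃,a₄,α₁,α₂,α₃,β₁,β₂,γ) on ℝ¹⁰ and Ĩ₁ = γα₂ − 2β₁β₂, Ĩ₂ = γ(α₁+α₃) + β₂² − β₁², Ĩ₃ = γ²(a₁−3a₃) + 3γ(β₂α₂ − β₁(α₁+α₃)) + 2β₁(β₁²−3β₂²), Ĩ₄ = γ²(3a₂−a₄) − 3γ(β₁α₂ + β₂(α₁+α₃)) + 2β₂(3β₁²−β₂²), Ĩ₅ = γ, define the four polynomial functions I₁ = 2(Ĩ₁² − 3Ĩ₂²)Ĩ₁Ĩ₃Ĩ₄ + (3Ĩ₁² − Ĩ₂²)Ĩ₂(Ĩ₃² − Ĩ₄²), I₂ = Ĩ₁²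 + Ĩ₂², I₃ = Ĩ₃² + Ĩ₄², I₄ = Ĩ₅. Then each of I₁, I₂, I₃, I₄ is annihilated at every point of ℝ¹⁰ by every one of the six vector fields V₁, V₂, V₃, T₁, T₂, T₃; i.e., these four functions are invariants of the full induced action of the isometry group of the Euclidean plane on the space of non-trivial valence-three Killing tensors. -/
/- STATEMENT 10: The four polynomials I₁, I₂, I₃, I₄ built from Ĩ₁,…,Ĩ₅ are annihilated
by all six vector fields V₁, V₂, V₃, T₁, T₂, T₃ on the parameter space ℝ¹⁰, i.e. they are
invariants of the full induced action of the isometry group of the Euclidean plane. -/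

noncomputable section

/-- Ĩ₁ = γα₂ − 2β₁β₂ -/
def It₁ : (Fin 10 → ℝ) → ℝ := fun x => x 9 * x 5 - 2 * x 7 * x 8

/-- Ĩ₂ = γ(α₁ + α₃) + β₂² − β₁² -/
def It₂ : (Fin 10 → ℝ) → ℝ := fun x => x 9 * (x 4 + x 6) + x 8 ^ 2 - x 7 ^ 2

/-- Ĩ₃ = γ²(a₁ − 3a₃) + 3γ(β₂α₂ − β₁(α₁ + α₃)) + 2β₁(β₁² − 3β₂²) -/
def It₃ : (Fin 10 → ℝ) → ℝ := fun x =>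
  x 9 ^ 2 * (x 0 - 3 * x 2) + 3 * x 9 * (x 8 * x 5 - x 7 * (x 4 + x 6)) +
  2 * x 7 * (x 7 ^ 2 - 3 * x 8 ^ 2)

/-- Ĩ₄ = γ²(3a₂ − a₄) − 3γ(β₁α₂ + β₂(α₁ + α₃)) + 2β₂(3β₁² − β₂²) -/
def It₄ : (Fin 10 → ℝ) → ℝ := fun x =>
  x 9 ^ 2 * (3 * x 1 - x 3) - 3 * x 9 * (x 7 * x 5 + x 8 * (x 4 + x 6)) +
  2 * x 8 * (3 * x 7 ^ 2 - x 8 ^ 2)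

/-- Ĩ₅ = γ -/
def It₅ : (Fin 10 → ℝ) → ℝ := fun x => x 9

/-- I₁ = 2(Ĩ₁² − 3Ĩ₂²)Ĩ₁Ĩ₃Ĩ₄ + (3Ĩ₁² − Ĩ₂²)Ĩ₂(Ĩ₃² − Ĩ₄²) -/
def I₁ : (Fin 10 → ℝ) → ℝ := fun x =>
  2 * (It₁ x ^ 2 - 3 * It₂ x ^ 2) * It₁ x * It₃ x * It₄ x +
  (3 * It₁ x ^ 2 - It₂ x ^ 2) * It₂ x * (It₃ x ^ 2 - It₄ x ^ 2)

/-- I₂ = Ĩ₁² + Ĩ₂² -/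
def I₂ : (Fin 10 → ℝ) → ℝ := fun x => It₁ x ^ 2 + It₂ x ^ 2

/-- I₃ = Ĩ₃² + Ĩ₄² -/
def I₃ : (Fin 10 → ℝ) → ℝ := fun x => It₃ x ^ 2 + It₄ x ^ 2

/-- I₄ = Ĩ₅ -/
def I₄ : (Fin 10 → ℝ) → ℝ := fun x => It₅ x

theorem differentiable_It₁ : Differentiable ℝ It₁ := by unfold It₁; fun_prop

theorem differentiable_It₂ : Differentiable ℝ It₂ := by unfold It₂; fun_prop

theorem differentiable_It₃ : Differentiable ℝ It₃ := by unfold It₃; fun_prop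

theorem differentiable_It₄ : Differentiable ℝ It₄ := by unfold It₄; fun_prop

theorem hasDerivAt_coord_line (x v : Fin 10 → ℝ) (i : Fin 10) :
    HasDerivAt (fun t : ℝ => (x + t • v) i) (v i) 0 := by
  simpa using ((hasDerivAt_id (0 : ℝ)).mul_const (v i)).const_add (x i)

theorem fderiv_eq_of_hasDerivAt_line {F : (Fin 10 → ℝ) → ℝ} (hF : Differentiable ℝ F)
    {x v : Fin 10 → ℝ} {c : ℝ} (h : HasDerivAt (fun t : ℝ => F (x + t • v)) c 0) :
    fderiv ℝ F x v = c :=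
  HasLineDerivAt.unique ((hF x).hasFDerivAt.hasLineDerivAt v) h

theorem fderiv_It₁ (x v : Fin 10 → ℝ) :
    fderiv ℝ It₁ x v = v 9 * x 5 + x 9 * v 5 - 2 * (v 7 * x 8 + x 7 * v 8) := by
  have d := hasDerivAt_coord_line x v
  refine fderiv_eq_of_hasDerivAt_line differentiable_It₁ ?_
  exact HasDerivAt.congr_deriv
    (((d 9).mul (d 5)).sub (((d 7).const_mul 2).mul (d 8))) (by simp; ring)

theorem fderiv_It₂ (x v : Fin 10 → ℝ) :
    fderiv ℝ It₂ x v =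
      v 9 * (x 4 + x 6) + x 9 * (v 4 + v 6) + 2 * x 8 * v 8 - 2 * x 7 * v 7 := by
  have d := hasDerivAt_coord_line x v
  refine fderiv_eq_of_hasDerivAt_line differentiable_It₂ ?_
  exact HasDerivAt.congr_deriv
    ((((d 9).mul ((d 4).add (d 6))).add ((d 8).pow 2)).sub ((d 7).pow 2)) (by simp)

theorem fderiv_It₃ (x v : Fin 10 → ℝ) :
    fderiv ℝ It₃ x v =
      2 * x 9 * v 9 * (x 0 - 3 * x 2) + x 9 ^ 2 * (v 0 - 3 * v 2) +
      3 * v 9 * (x 8 * x 5 - x 7 * (x 4 + x 6)) +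
      3 * x 9 * (v 8 * x 5 + x 8 * v 5 - v 7 * (x 4 + x 6) - x 7 * (v 4 + v 6)) +
      2 * v 7 * (x 7 ^ 2 - 3 * x 8 ^ 2) + 2 * x 7 * (2 * x 7 * v 7 - 6 * x 8 * v 8) := by
  have d := hasDerivAt_coord_line x v
  refine fderiv_eq_of_hasDerivAt_line differentiable_It₃ ?_
  exact HasDerivAt.congr_deriv
    (((((d 9).pow 2).mul ((d 0).sub ((d 2).const_mul 3))).add
    (((d 9).const_mul 3).mul (((d 8).mul (d 5)).sub ((d 7).mul ((d 4).add (d 6)))))).add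
    (((d 7).const_mul 2).mul (((d 7).pow 2).sub (((d 8).pow 2).const_mul 3)))) (by simp; ring)

theorem fderiv_It₄ (x v : Fin 10 → ℝ) :
    fderiv ℝ It₄ x v =
      2 * x 9 * v 9 * (3 * x 1 - x 3) + x 9 ^ 2 * (3 * v 1 - v 3) -
      3 * v 9 * (x 7 * x 5 + x 8 * (x 4 + x 6)) -
      3 * x 9 * (v 7 * x 5 + x 7 * v 5 + v 8 * (x 4 + x 6) + x 8 * (v 4 + v 6)) +
      2 * v 8 * (3 * x 7 ^ 2 - x 8 ^ 2) + 2 * x 8 * (6 * x 7 * v 7 - 2 * x 8 * v 8) := by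
  have d := hasDerivAt_coord_line x v
  refine fderiv_eq_of_hasDerivAt_line differentiable_It₄ ?_
  exact HasDerivAt.congr_deriv
    (((((d 9).pow 2).mul (((d 1).const_mul 3).sub (d 3))).sub
    (((d 9).const_mul 3).mul (((d 7).mul (d 5)).add ((d 8).mul ((d 4).add (d 6)))))).add
    (((d 8).const_mul 2).mul ((((d 7).pow 2).const_mul 3).sub ((d 8).pow 2)))) (by simp; ring)

/-- Each of the six fields acts on the pairs `(It₁, It₂)` and `(It₃, It₄)` by infinitesimal
rotations with speeds in the ratio `2 : 3`, and fixes the coordinate `γ`. -/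
theorem exists_rotation_speed (x : Fin 10 → ℝ) {W : (Fin 10 → ℝ) → (Fin 10 → ℝ)}
    (hW : W ∈ ({V₁, V₂, V₃, T₁, T₂, T₃} : Set ((Fin 10 → ℝ) → (Fin 10 → ℝ)))) :
    ∃ c : ℝ, fderiv ℝ It₁ x (W x) = -(2 * c) * It₂ x ∧ fderiv ℝ It₂ x (W x) = 2 * c * It₁ x ∧
      fderiv ℝ It₃ x (W x) = 3 * c * It₄ x ∧ fderiv ℝ It₄ x (W x) = -(3 * c) * It₃ x ∧
      W x 9 = 0 := by
  simp only [fderiv_It₁, fderiv_It₂, fderiv_It₃, fderiv_It₄]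
  rcases hW with rfl | rfl | rfl | rfl | rfl | rfl
  map_tacs [refine ⟨0, ?_⟩; refine ⟨0, ?_⟩; refine ⟨1, ?_⟩; refine ⟨0, ?_⟩; refine ⟨0, ?_⟩;
    refine ⟨0, ?_⟩]
  all_goals
    simp only [V₁, V₂, V₃, T₁, T₂, T₃, It₁, It₂, It₃, It₄]
    refine ⟨?_, ?_, ?_, ?_, ?_⟩ <;> simp <;> ring

theorem essential_invariants_of_isometry_group_action :
    ∀ x : Fin 10 → ℝ,
      ∀ F ∈ ({I₁, I₂, I₃, I₄} : Set ((Fin 10 → ℝ) → ℝ)),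
        ∀ W ∈ ({V₁, V₂, V₃, T₁, T₂, T₃} : Set ((Fin 10 → ℝ) → (Fin 10 → ℝ))),
          fderiv ℝ F x (W x) = 0 := by
  intro x F hF W hW
  obtain ⟨c, h₁, h₂, h₃, h₄, h₅⟩ := exists_rotation_speed x hW
  have d₁ := (differentiable_It₁ x).hasFDerivAt
  have d₂ := (differentiable_It₂ x).hasFDerivAt
  have d₃ := (differentiable_It₃ x).hasFDerivAt
  have d₄ := (differentiable_It₄ x).hasFDerivAt
  rcases hF with rfl | rfl | rfl | rfl
  · have h : HasFDerivAt I₁ _ x :=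
      (((((((d₁.pow 2).sub ((d₂.pow 2).const_mul 3)).const_mul 2).mul d₁).mul d₃).mul d₄)).add
        (((((d₁.pow 2).const_mul 3).sub (d₂.pow 2)).mul d₂).mul ((d₃.pow 2).sub (d₄.pow 2)))
    rw [h.fderiv]
    simp [h₁, h₂, h₃, h₄]
    ring
  · have h : HasFDerivAt I₂ _ x := (d₁.pow 2).add (d₂.pow 2)
    rw [h.fderiv]
    simp [h₁, h₂]
    ring
  · have h : HasFDerivAt I₃ _ x := (d₃.pow 2).add (d₄.pow 2)
    rw [h.fderiv]
    simp [h₃, h₄]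
    ring
  · have h : HasFDerivAt I₄ _ x := hasFDerivAt_apply (𝕜 := ℝ) (9 : Fin 10) x
    rw [h.fderiv]
    exact h₅
end
end
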